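/- arXiv:2502.15319 — 4 statements merged into one kernel-verified Lean document; each statement's English description precedes it below -/
import Mathlib

section
/- For every compactly supported V in the Kato class K_n and every ε > 0, there exists a test function V♭ ∈ D(R^n) with ‖V♭‖_{K_n} ≤ ‖V‖_{K_n} and ‖V − V♭‖_{K_n} < ε. -/
open MeasureTheory Filter Metric

/-- The Kato-class condition in dimension `n ≥ 3`. -/
def InKatoClass (n : ℕ) (V : EuclideanSpace ℝ (Fin n) → ℝ) : Prop :=
  LocallyIntegrable V volume ∧
    Tendsto
      (fun r : ℝ => ⨆ x : EuclideanSpace ℝ (Fin n),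
        ∫⁻ y in ball x r, ENNReal.ofReal (‖x - y‖ ^ ((2 : ℝ) - n) * |V y|))
      (nhdsWithin 0 (Set.Ioi 0)) (nhds 0)

/-- The global Kato norm. -/
noncomputable def katoNorm (n : ℕ) (V : EuclideanSpace ℝ (Fin n) → ℝ) : ENNReal :=
  ⨆ x : EuclideanSpace ℝ (Fin n),
    ∫⁻ y, ENNReal.ofReal (‖x - y‖ ^ ((2 : ℝ) - n) * |V y|)

open scoped Convolution Topology

/-- Mollification does not increase the supremum of a potential-type integral. -/
theorem kato_conv_bound {n : ℕ} (K : EuclideanSpace ℝ (Fin n) → ENNReal) (hK : Measurable K)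
    (φ V : EuclideanSpace ℝ (Fin n) → ℝ) (hφ : Continuous φ)
    (hφ1 : ∫⁻ t, ‖φ t‖ₑ = 1) (hV : AEStronglyMeasurable V volume) (C : ENNReal)
    (hC : ∀ x, ∫⁻ y, K (x - y) * ‖V y‖ₑ ≤ C) (x : EuclideanSpace ℝ (Fin n)) :
    ∫⁻ y, K (x - y) * ‖(φ ⋆[ContinuousLinearMap.lsmul ℝ ℝ, volume] V) y‖ₑ ≤ C := by
  have hm := (hφ.aestronglyMeasurable (μ := volume)).convolution_integrand
    (ContinuousLinearMap.lsmul ℝ ℝ) hV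
  have hm1 : ∀ y, AEMeasurable (fun t => ‖φ t * V (y - t)‖ₑ) := fun y =>
    ((hφ.aestronglyMeasurable (μ := volume)).convolution_integrand_snd
      (ContinuousLinearMap.lsmul ℝ ℝ) hV y).enorm
  have hm2 : AEMeasurable (Function.uncurry fun y t => K (x - y) * ‖φ t * V (y - t)‖ₑ)
      ((volume : Measure (EuclideanSpace ℝ (Fin n))).prod volume) := by
    have h1 : Measurable fun p : EuclideanSpace ℝ (Fin n) × EuclideanSpace ℝ (Fin n) =>
      K (x - p.1) := hK.comp (by fun_prop)
    exact h1.aemeasurable.mul hm.enorm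
  calc ∫⁻ y, K (x - y) * ‖(φ ⋆[ContinuousLinearMap.lsmul ℝ ℝ, volume] V) y‖ₑ
      ≤ ∫⁻ y, ∫⁻ t, K (x - y) * ‖φ t * V (y - t)‖ₑ := by
        refine lintegral_mono fun y => ?_
        rw [lintegral_const_mul'' _ (hm1 y)]
        gcongr
        exact enorm_integral_le_lintegral_enorm _
    _ = ∫⁻ t, ∫⁻ y, K (x - y) * ‖φ t * V (y - t)‖ₑ := lintegral_lintegral_swap hm2
    _ ≤ ∫⁻ t, ‖φ t‖ₑ * C := by
        refine lintegral_mono fun t => ?_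
        have e1 : ∀ y, K (x - y) * ‖φ t * V (y - t)‖ₑ
            = ‖φ t‖ₑ * (K ((x - t) - (y - t)) * ‖V (y - t)‖ₑ) := by
          intro y
          rw [enorm_mul, sub_sub_sub_cancel_right]; ring
        simp_rw [e1]
        rw [lintegral_const_mul' _ _ enorm_ne_top,
          lintegral_sub_right_eq_self (fun y => K ((x - t) - y) * ‖V y‖ₑ) t]
        gcongr
        exact hC _
    _ = C := by
        rw [lintegral_mul_const _ hφ.enorm.measurable, hφ1, one_mul]

/-- Mollification error in `L¹`. -/
theorem kato_conv_L1 {n : ℕ} (φ V : EuclideanSpace ℝ (Fin n) → ℝ) (hφ : Continuous φ)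
    (hφc : HasCompactSupport φ) (hφ1 : ∫⁻ t, ‖φ t‖ₑ = 1) (hφ2 : ∫ t, φ t = 1)
    (hV : LocallyIntegrable V volume) (C : ENNReal)
    (hC : ∀ t, φ t ≠ 0 → ∫⁻ y, ‖V y - V (y - t)‖ₑ ≤ C) :
    ∫⁻ y, ‖V y - (φ ⋆[ContinuousLinearMap.lsmul ℝ ℝ, volume] V) y‖ₑ ≤ C := by
  have hVm := hV.aestronglyMeasurable
  have hφi : Integrable φ := hφ.integrable_of_hasCompactSupport hφc
  have hm := (hφ.aestronglyMeasurable (μ := volume)).convolution_integrand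
    (ContinuousLinearMap.lsmul ℝ ℝ) hVm
  have hm2 : AEMeasurable (Function.uncurry fun y t => ‖φ t * V y - φ t * V (y - t)‖ₑ)
      ((volume : Measure (EuclideanSpace ℝ (Fin n))).prod volume) := by
    have h2 : AEStronglyMeasurable (fun p : EuclideanSpace ℝ (Fin n) × EuclideanSpace ℝ (Fin n) =>
      φ p.2 * V p.1) ((volume : Measure (EuclideanSpace ℝ (Fin n))).prod volume) :=
      (hφ.aestronglyMeasurable.comp_snd).mul hVm.comp_fst
    exact (h2.sub hm).enorm
  calc ∫⁻ y, ‖V y - (φ ⋆[ContinuousLinearMap.lsmul ℝ ℝ, volume] V) y‖ₑ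
      ≤ ∫⁻ y, ∫⁻ t, ‖φ t * V y - φ t * V (y - t)‖ₑ := by
        refine lintegral_mono fun y => ?_
        have hi : Integrable (fun t => φ t * V (y - t)) :=
          hφc.convolutionExists_left (ContinuousLinearMap.lsmul ℝ ℝ) hφ hV y
        have e : V y - (φ ⋆[ContinuousLinearMap.lsmul ℝ ℝ, volume] V) y
            = ∫ t, (φ t * V y - φ t * V (y - t)) := by
          rw [integral_sub (hφi.mul_const _) hi, integral_mul_const, hφ2, one_mul]
          rfl
        rw [e]
        exact enorm_integral_le_lintegral_enorm _
    _ = ∫⁻ t, ∫⁻ y, ‖φ t * V y - φ t * V (y - t)‖ₑ := lintegral_lintegral_swap hm2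
    _ ≤ ∫⁻ t, ‖φ t‖ₑ * C := by
        refine lintegral_mono fun t => ?_
        simp_rw [← mul_sub, enorm_mul]
        rw [lintegral_const_mul' _ _ enorm_ne_top]
        by_cases h : φ t = 0
        · simp [h]
        · gcongr
          exact hC t h
    _ = C := by
        rw [lintegral_mul_const _ hφ.enorm.measurable, hφ1, one_mul]

/-- Continuity of translations in `L¹`. -/
theorem kato_translation {n : ℕ} (V : EuclideanSpace ℝ (Fin n) → ℝ) (hV : Integrable V)
    (η : ENNReal) (hη : 0 < η) :
    ∃ δ > 0, ∀ t : EuclideanSpace ℝ (Fin n), ‖t‖ < δ → ∫⁻ y, ‖V y - V (y - t)‖ₑ ≤ η := by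
  have hVp : MemLp V 1 volume := memLp_one_iff_integrable.2 hV
  have : Fact ((1 : ENNReal) ≠ ⊤) := ⟨ENNReal.one_ne_top⟩
  have hc : Continuous fun t : EuclideanSpace ℝ (Fin n) =>
      edist (hVp.toLp V) (DomAddAct.mk (-t) +ᵥ hVp.toLp V) := by
    have h0 : Continuous fun t : EuclideanSpace ℝ (Fin n) => DomAddAct.mk (-t) :=
      DomAddAct.continuous_mk.comp continuous_neg
    exact continuous_const.edist (h0.vadd continuous_const)
  have ht := hc.tendsto 0
  have e0 : edist (hVp.toLp V) (DomAddAct.mk (-(0 : EuclideanSpace ℝ (Fin n))) +ᵥ hVp.toLp V)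
      = 0 := by simp
  rw [e0] at ht
  obtain ⟨δ, hδ, h⟩ := Metric.eventually_nhds_iff.1 (ht.eventually (gt_mem_nhds hη))
  refine ⟨δ, hδ, fun t htt => ?_⟩
  have := (h (y := t) (by simpa using htt)).le
  rw [DomAddAct.mk_vadd_toLp, Lp.edist_toLp_toLp, eLpNorm_one_eq_lintegral_enorm] at this
  simpa [sub_eq_add_neg, add_comm] using this

/-- The truncated kernel lower-level facts, splitting into near and far regions. -/
theorem kato_split {n : ℕ} (hn : 3 ≤ n) (W : EuclideanSpace ℝ (Fin n) → ℝ)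
    (r : ℝ) (hr : 0 < r) (x : EuclideanSpace ℝ (Fin n)) :
    ∫⁻ y, ENNReal.ofReal (‖x - y‖ ^ ((2 : ℝ) - n) * |W y|) ≤
      (∫⁻ y in ball x r, ENNReal.ofReal (‖x - y‖ ^ ((2 : ℝ) - n) * |W y|)) +
        ENNReal.ofReal (r ^ ((2 : ℝ) - n)) * ∫⁻ y, ‖W y‖ₑ := by
  rw [← lintegral_add_compl _ (measurableSet_ball (x := x) (ε := r))]
  gcongr
  rw [← lintegral_const_mul' _ _ ENNReal.ofReal_ne_top]
  refine le_trans (setLIntegral_mono' measurableSet_ball.compl fun y hy => ?_)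
    (setLIntegral_le_lintegral _ _)
  rw [ENNReal.ofReal_mul (by positivity), ← Real.norm_eq_abs, ofReal_norm]
  gcongr ENNReal.ofReal ?_ * _
  have hy' : r ≤ ‖x - y‖ := by
    rw [← dist_eq_norm, dist_comm]
    simpa using hy
  refine Real.rpow_le_rpow_of_nonpos hr hy' ?_
  have : (3 : ℝ) ≤ n := by exact_mod_cast hn
  linarith

theorem kato_kernel_eq {n : ℕ} (W : EuclideanSpace ℝ (Fin n) → ℝ)
    (x : EuclideanSpace ℝ (Fin n)) :
    ∫⁻ y, ENNReal.ofReal (‖x - y‖ ^ ((2 : ℝ) - n) * |W y|) =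
      ∫⁻ y, (fun z => ENNReal.ofReal (‖z‖ ^ ((2 : ℝ) - n))) (x - y) * ‖W y‖ₑ := by
  refine lintegral_congr fun y => ?_
  rw [ENNReal.ofReal_mul (by positivity), ← Real.norm_eq_abs, ofReal_norm]

theorem kato_near_eq {n : ℕ} (W : EuclideanSpace ℝ (Fin n) → ℝ) (r : ℝ)
    (x : EuclideanSpace ℝ (Fin n)) :
    ∫⁻ y in ball x r, ENNReal.ofReal (‖x - y‖ ^ ((2 : ℝ) - n) * |W y|) =
      ∫⁻ y, ((ball 0 r).indicator fun z => ENNReal.ofReal (‖z‖ ^ ((2 : ℝ) - n))) (x - y)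
        * ‖W y‖ₑ := by
  rw [← lintegral_indicator measurableSet_ball]
  refine lintegral_congr fun y => ?_
  have hiff : y ∈ ball x r ↔ x - y ∈ ball (0 : EuclideanSpace ℝ (Fin n)) r := by
    rw [mem_ball_zero_iff, mem_ball, dist_comm, dist_eq_norm]
  by_cases h : y ∈ ball x r
  · rw [Set.indicator_of_mem h, Set.indicator_of_mem (hiff.1 h),
      ENNReal.ofReal_mul (by positivity), ← Real.norm_eq_abs, ofReal_norm]
  · rw [Set.indicator_of_notMem h, Set.indicator_of_notMem (fun h' => h (hiff.2 h')), zero_mul]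

/-- Every compactly supported Kato class potential can be approximated by test functions
in the global Kato norm, with Kato norm bounded by that of `V`. -/
theorem kato_approx_by_test_functions (n : ℕ) (hn : 3 ≤ n)
    (V : EuclideanSpace ℝ (Fin n) → ℝ)
    (hV : InKatoClass n V) (hsupp : HasCompactSupport V)
    (ε : ℝ) (hε : 0 < ε) :
    ∃ Vb : EuclideanSpace ℝ (Fin n) → ℝ,
      ContDiff ℝ (⊤ : ℕ∞) Vb ∧ HasCompactSupport Vb ∧
      katoNorm n Vb ≤ katoNorm n V ∧
      katoNorm n (fun x => V x - Vb x) < ENNReal.ofReal ε := by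
  obtain ⟨hloc, hlim⟩ := hV
  have hint : Integrable V :=
    (integrableOn_iff_integrable_of_support_subset (subset_tsupport V)).1
      (hloc.integrableOn_isCompact hsupp)
  set p : ℝ := (2 : ℝ) - n with hp
  have hKm : Measurable fun z : EuclideanSpace ℝ (Fin n) => ENNReal.ofReal (‖z‖ ^ p) :=
    (measurable_norm.pow_const p).ennreal_ofReal
  -- choice of the cut-off radius
  have hq : 0 < ENNReal.ofReal (ε / 4) := by
    rw [ENNReal.ofReal_pos]; positivity
  obtain ⟨r, hrlt, hr⟩ :=
    ((hlim.eventually (gt_mem_nhds hq)).and self_mem_nhdsWithin).exists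
  have hr : 0 < r := hr
  have hnear : ∀ x, ∫⁻ y in ball x r, ENNReal.ofReal (‖x - y‖ ^ p * |V y|)
      ≤ ENNReal.ofReal (ε / 4) := fun x =>
    (le_iSup (fun x => ∫⁻ y in ball x r, ENNReal.ofReal (‖x - y‖ ^ p * |V y|)) x).trans hrlt.le
  have hrp : 0 < r ^ p := Real.rpow_pos_of_pos hr p
  obtain ⟨δ, hδ, htr⟩ := kato_translation V hint (ENNReal.ofReal (ε / 4 / r ^ p))
    (by rw [ENNReal.ofReal_pos]; positivity)
  let b : ContDiffBump (0 : EuclideanSpace ℝ (Fin n)) := ⟨δ / 2, δ, by positivity, by linarith⟩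
  set φ : EuclideanSpace ℝ (Fin n) → ℝ := b.normed volume with hφdef
  have hφ : Continuous φ := b.continuous_normed
  have hφc : HasCompactSupport φ := b.hasCompactSupport_normed
  have hφ2 : ∫ t, φ t = 1 := b.integral_normed
  have hφ1 : ∫⁻ t, ‖φ t‖ₑ = 1 := by
    have h := ofReal_integral_eq_lintegral_ofReal (μ := volume) (hφ.integrable_of_hasCompactSupport hφc)
      (Eventually.of_forall fun t => b.nonneg_normed (μ := volume) t)
    rw [hφ2, ENNReal.ofReal_one] at h
    rw [h]
    exact lintegral_congr fun t => Real.enorm_of_nonneg (b.nonneg_normed (μ := volume) t)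
  have hφs : ∀ t, φ t ≠ 0 → ‖t‖ < δ := by
    intro t ht
    have h : t ∈ Function.support φ := ht
    rw [hφdef, b.support_normed_eq] at h
    simpa using h
  have hL1 := kato_conv_L1 φ V hφ hφc hφ1 hφ2 hloc _ fun t ht => htr t (hφs t ht)
  set U := φ ⋆[ContinuousLinearMap.lsmul ℝ ℝ, volume] V with hU
  have hUc : ContDiff ℝ (⊤ : ℕ∞) U :=
    hφc.contDiff_convolution_left _ b.contDiff_normed hloc
  have hUnear : ∀ x, ∫⁻ y in ball x r, ENNReal.ofReal (‖x - y‖ ^ p * |U y|)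
      ≤ ENNReal.ofReal (ε / 4) := by
    intro x
    rw [hp, kato_near_eq]
    refine kato_conv_bound _ (hKm.indicator measurableSet_ball) φ V hφ hφ1
      hloc.aestronglyMeasurable _ (fun z => ?_) x
    rw [← kato_near_eq]
    exact hnear z
  refine ⟨U, hUc, hφc.convolution _ hsupp, ?_, ?_⟩
  · refine iSup_le fun x => ?_
    rw [kato_kernel_eq]
    refine kato_conv_bound _ hKm φ V hφ hφ1 hloc.aestronglyMeasurable _ (fun z => ?_) x
    rw [← kato_kernel_eq]
    exact le_iSup (fun x => ∫⁻ y, ENNReal.ofReal (‖x - y‖ ^ ((2 : ℝ) - n) * |V y|)) z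
  · have hlt : ENNReal.ofReal (3 * (ε / 4)) < ENNReal.ofReal ε :=
      (ENNReal.ofReal_lt_ofReal_iff hε).2 (by linarith)
    refine lt_of_le_of_lt (iSup_le fun x => ?_) hlt
    refine (kato_split hn _ r hr x).trans ?_
    have h1 : ∫⁻ y in ball x r, ENNReal.ofReal (‖x - y‖ ^ p * |V y - U y|)
        ≤ ENNReal.ofReal (ε / 4) + ENNReal.ofReal (ε / 4) := by
      refine le_trans ?_ (add_le_add (hnear x) (hUnear x))
      rw [← lintegral_add_right]
      · refine lintegral_mono fun y => ?_
        rw [← ENNReal.ofReal_add (by positivity) (by positivity), ← mul_add]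
        gcongr
        exact abs_sub _ _
      · have hUm : Measurable U := hUc.continuous.measurable
        exact ((((measurable_const.sub measurable_id).norm).pow_const p).mul
          (continuous_abs.measurable.comp hUm)).ennreal_ofReal
    have h2 : ENNReal.ofReal (r ^ p) * ∫⁻ y, ‖V y - U y‖ₑ ≤ ENNReal.ofReal (ε / 4) := by
      calc _ ≤ ENNReal.ofReal (r ^ p) * ENNReal.ofReal (ε / 4 / r ^ p) := by gcongr
        _ = ENNReal.ofReal (ε / 4) := by
          rw [← ENNReal.ofReal_mul hrp.le, mul_div_cancel₀ _ hrp.ne']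
    refine (add_le_add h1 h2).trans (le_of_eq ?_)
    rw [← ENNReal.ofReal_add (by positivity) (by positivity),
      ← ENNReal.ofReal_add (by positivity) (by positivity)]
    congr 1; ring
end

section
/- For every x ≠ 0 and y > 0, the improper integral ∫_0^∞ e^{ixξ} K_0(ξ + iy) dξ converges absolutely and equals ∫_0^∞ e^{−iy cosh t} / (cosh t − ix) dt, where K_0 is the modified Bessel function of the second kind. -/
open MeasureTheory Complex

/-- The modified Bessel function of the second kind of order `0`,
`K₀(w) = ∫_0^∞ e^{-w cosh t} dt` (for `Re w > 0`). -/
noncomputable def besselK0 (w : ℂ) : ℂ :=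
  ∫ t in Set.Ioi (0 : ℝ), Complex.exp (-(w * Real.cosh t))

lemma inv_cosh_integrableOn : IntegrableOn (fun t : ℝ => (Real.cosh t)⁻¹) (Set.Ioi 0) := by
  have h : IntegrableOn (fun t : ℝ => 2 * Real.exp (-t)) (Set.Ioi 0) :=
    (integrableOn_exp_neg_Ioi 0).const_mul 2
  refine h.mono' ?_ ?_
  · exact (Real.continuous_cosh.inv₀ (fun t => (Real.cosh_pos t).ne')).aestronglyMeasurable
  · refine Filter.Eventually.of_forall fun t => ?_
    have h0 := Real.cosh_pos t
    rw [Real.norm_of_nonneg (by positivity), Real.exp_neg, Real.cosh_eq, inv_div,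
      ← div_eq_mul_inv]
    gcongr
    linarith [Real.exp_pos (-t)]

lemma kernel_eq (x y ξ t : ℝ) :
    Complex.exp (I * x * ξ) * Complex.exp (-(((ξ : ℂ) + I * y) * Real.cosh t)) =
    Complex.exp (-(I * y * Real.cosh t)) *
      Complex.exp ((I * x - (Real.cosh t : ℂ)) * ξ) := by
  rw [← Complex.exp_add, ← Complex.exp_add]
  congr 1
  ring

lemma kernel_norm (x y ξ t : ℝ) :
    ‖Complex.exp (I * x * ξ) * Complex.exp (-(((ξ : ℂ) + I * y) * Real.cosh t))‖ =
    Real.exp (-Real.cosh t * ξ) := by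
  rw [← Complex.exp_add, Complex.norm_exp]
  congr 1
  simp [-Complex.ofReal_cosh]
  ring

lemma kernel_integrable (x y : ℝ) :
    Integrable (Function.uncurry fun ξ t : ℝ =>
      Complex.exp (I * x * ξ) * Complex.exp (-(((ξ : ℂ) + I * y) * Real.cosh t)))
      ((volume.restrict (Set.Ioi 0)).prod (volume.restrict (Set.Ioi 0))) := by
  have hc : Continuous (Function.uncurry fun ξ t : ℝ =>
      Complex.exp (I * x * ξ) * Complex.exp (-(((ξ : ℂ) + I * y) * Real.cosh t))) := by
    have := Real.continuous_cosh
    unfold Function.uncurry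
    fun_prop
  rw [integrable_prod_iff' hc.aestronglyMeasurable]
  constructor
  · refine Filter.Eventually.of_forall fun t => ?_
    simp only [Function.uncurry, kernel_eq]
    refine Integrable.const_mul ?_ _
    refine integrableOn_exp_mul_complex_Ioi ?_ 0
    simpa [-Complex.ofReal_cosh] using Real.cosh_pos t
  · simp only [Function.uncurry, kernel_norm]
    refine inv_cosh_integrableOn.congr (Filter.Eventually.of_forall fun t => ?_)
    have := integral_exp_mul_Ioi (a := -Real.cosh t) (by simpa using Real.cosh_pos t) 0
    simp only [this]
    simp

/-- For `x ≠ 0` and `y > 0`, `∫_0^∞ e^{ixξ} K₀(ξ + iy) dξ` converges absolutely and equals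
`∫_0^∞ e^{-iy cosh t}/(cosh t − ix) dt`. -/
theorem integral_exp_mul_besselK0 (x y : ℝ) (hx : x ≠ 0) (hy : 0 < y) :
    IntegrableOn (fun ξ : ℝ => Complex.exp (I * x * ξ) * besselK0 (ξ + I * y))
      (Set.Ioi 0) volume ∧
    (∫ ξ in Set.Ioi (0 : ℝ), Complex.exp (I * x * ξ) * besselK0 (ξ + I * y))
      = ∫ t in Set.Ioi (0 : ℝ),
          Complex.exp (-(I * y * Real.cosh t)) / ((Real.cosh t : ℂ) - I * x) := by
  have hI := kernel_integrable x y
  simp only [besselK0, ← integral_const_mul]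
  refine ⟨hI.integral_prod_left, ?_⟩
  rw [integral_integral_swap hI]
  congr 1
  ext t
  simp only [kernel_eq]
  have hre : (I * x - (Real.cosh t : ℂ)).re < 0 := by
    simpa [-Complex.ofReal_cosh] using Real.cosh_pos t
  rw [integral_const_mul]
  have := integral_exp_mul_complex_Ioi hre 0
  rw [this, ← neg_sub (Real.cosh t : ℂ) (I * x)]
  simp only [Complex.ofReal_zero, mul_zero, Complex.exp_zero, div_eq_mul_inv, inv_neg, neg_mul_neg,
    one_mul]
end

section
/- For all real x ≠ 0 and y > 0, |Re ∫_0^∞ e^{ixξ} K_0(ξ + iy) dξ| ≤ 3π/(2|x|). -/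
open MeasureTheory Complex

lemma bk_S_bound (x y : ℝ) (hx : x ≠ 0) (hy : 0 < y) (R : ℝ) (hR : Real.arsinh (√2 / y) ≤ R) :
    |∫ t in (0:ℝ)..R, x ^ 2 * Real.sin (y * Real.cosh t) / (Real.cosh t ^ 2 + x ^ 2)| ≤ 2 * √2 := by
  set T := Real.arsinh (√2 / y) with hTdef
  have h2 : (0:ℝ) < √2 := by positivity
  have h22 : √2 * √2 = 2 := Real.mul_self_sqrt (by norm_num)
  have hT0 : 0 < T := Real.arsinh_pos_iff.mpr (by positivity)
  have hsT : Real.sinh T = √2 / y := Real.sinh_arsinh _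
  have hx2 : 0 < x ^ 2 := by positivity
  set f : ℝ → ℝ := fun t => x ^ 2 * Real.sin (y * Real.cosh t) / (Real.cosh t ^ 2 + x ^ 2) with hf
  have hden : ∀ t, 0 < Real.cosh t ^ 2 + x ^ 2 := fun t => by positivity
  have hfc : Continuous f := by
    refine Continuous.div (by fun_prop) (by fun_prop) fun t => (hden t).ne'
  -- first part
  have hb1 : ∀ t, |f t| ≤ y * Real.cosh t := by
    intro t
    have hc := Real.cosh_pos t
    simp only [hf]
    rw [abs_div, abs_mul, abs_of_pos (hden t), abs_of_pos hx2, div_le_iff₀ (hden t)]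
    have h1 : |Real.sin (y * Real.cosh t)| ≤ y * Real.cosh t :=
      (Real.abs_sin_le_abs).trans (abs_of_pos (by positivity)).le
    have h3 : 0 < y * Real.cosh t := by positivity
    nlinarith [sq_nonneg (Real.cosh t), mul_le_mul_of_nonneg_left h1 hx2.le]
  have hA : |∫ t in (0:ℝ)..T, f t| ≤ √2 := by
    have e : ∫ t in (0:ℝ)..T, y * Real.cosh t = √2 := by
      rw [intervalIntegral.integral_eq_sub_of_hasDerivAt (f := fun t => y * Real.sinh t)]
      · rw [hsT]; field_simp; simp
      · intro t _; exact (Real.hasDerivAt_sinh t).const_mul y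
      · exact Continuous.intervalIntegrable (by fun_prop) _ _
    rw [← e]
    rw [← Real.norm_eq_abs]
    exact intervalIntegral.norm_integral_le_of_norm_le (g := fun t => y * Real.cosh t) hT0.le
      (Filter.Eventually.of_forall fun t _ => hb1 t) (Continuous.intervalIntegrable (by fun_prop) _ _)
  -- second part
  set H : ℝ → ℝ := fun t => x ^ 2 / (Real.sinh t * (Real.cosh t ^ 2 + x ^ 2)) with hH
  set H' : ℝ → ℝ := fun t => - (x ^ 2 * (Real.cosh t * (Real.cosh t ^ 2 + x ^ 2) +
    Real.sinh t * (2 * Real.cosh t * Real.sinh t))) / (Real.sinh t * (Real.cosh t ^ 2 + x ^ 2)) ^ 2 with hH'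
  have hs : ∀ t, T ≤ t → 0 < Real.sinh t := fun t ht => Real.sinh_pos_iff.mpr (hT0.trans_le ht)
  have hHpos : ∀ t, T ≤ t → 0 < H t := fun t ht => by
    have := hs t ht; have := hden t; simp only [hH]; positivity
  have hHd : ∀ t, T ≤ t → HasDerivAt H (H' t) t := by
    intro t ht
    have h1 : HasDerivAt (fun t => Real.sinh t * (Real.cosh t ^ 2 + x ^ 2))
        (Real.cosh t * (Real.cosh t ^ 2 + x ^ 2) +
          Real.sinh t * (2 * Real.cosh t * Real.sinh t)) t := by
      have := (Real.hasDerivAt_sinh t).mul (((Real.hasDerivAt_cosh t).pow 2).add_const (x ^ 2))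
      refine this.congr_deriv ?_
      simp
    have := (hasDerivAt_const t (x ^ 2)).div h1 (mul_pos (hs t ht) (hden t)).ne'
    refine this.congr_deriv ?_
    simp [hH']
  have hH'neg : ∀ t, T ≤ t → H' t ≤ 0 := by
    intro t ht
    have := hs t ht; have := hden t; have := Real.cosh_pos t
    simp only [hH']
    rw [neg_div]
    exact neg_nonpos.mpr (by positivity)
  have hFd : ∀ t, T ≤ t → HasDerivAt (fun t => - Real.cos (y * Real.cosh t) * H t / y)
      (f t - Real.cos (y * Real.cosh t) * H' t / y) t := by
    intro t ht
    have h1 := (((Real.hasDerivAt_cosh t).const_mul y).cos.neg.mul (hHd t ht)).div_const y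
    refine h1.congr_deriv ?_
    have := hs t ht; have := hden t
    simp only [hf, hH, Pi.neg_apply]
    field_simp
    ring
  have hHT : H T / y ≤ √2 / 2 := by
    have : H T ≤ 1 / Real.sinh T := by
      simp only [hH]
      have h1 := hs T le_rfl
      rw [div_le_div_iff₀ (mul_pos h1 (hden T)) h1]
      nlinarith [mul_pos h1 (pow_pos (Real.cosh_pos T) 2)]
    rw [hsT] at this
    calc H T / y ≤ (1 / (√2 / y)) / y := by gcongr
      _ = √2 / 2 := by field_simp; linarith
  have hup : ∫ t in T..R, f t ≤ √2 := by
    have hd : ∀ t, T ≤ t → HasDerivAt (fun t => - Real.cos (y * Real.cosh t) * H t / y - H t / y)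
      (f t - Real.cos (y * Real.cosh t) * H' t / y - H' t / y) t :=
      fun t ht => (hFd t ht).sub ((hHd t ht).div_const y)
    have := intervalIntegral.integral_le_sub_of_hasDeriv_right_of_le hR
      (fun t ht => (hd t ht.1).continuousAt.continuousWithinAt)
      (fun t ht => (hd t ht.1.le).hasDerivWithinAt) (φ := f) hfc.integrableOn_Icc
      (fun t ht => by
        have h1 := Real.neg_one_le_cos (y * Real.cosh t)
        have h3 : 0 ≤ -((1 + Real.cos (y * Real.cosh t)) * H' t / y) := by
          rw [← neg_div]
          exact div_nonneg (by nlinarith [hH'neg t ht.1.le]) hy.le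
        have : (1 + Real.cos (y * Real.cosh t)) * H' t / y
          = Real.cos (y * Real.cosh t) * H' t / y + H' t / y := by ring
        linarith)
    have hc1 := Real.neg_one_le_cos (y * Real.cosh R)
    have hc2 := Real.cos_le_one (y * Real.cosh T)
    have a1 : - Real.cos (y * Real.cosh R) * H R / y - H R / y ≤ 0 := by
      have : 0 ≤ (1 + Real.cos (y * Real.cosh R)) * H R / y :=
        div_nonneg (mul_nonneg (by linarith) (hHpos R hR).le) hy.le
      have e : (1 + Real.cos (y * Real.cosh R)) * H R / y
        = -(- Real.cos (y * Real.cosh R) * H R / y - H R / y) := by ring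
      linarith
    have a2 : - (- Real.cos (y * Real.cosh T) * H T / y - H T / y) ≤ 2 * (H T / y) := by
      have : 0 ≤ (1 - Real.cos (y * Real.cosh T)) * H T / y :=
        div_nonneg (mul_nonneg (by linarith) (hHpos T le_rfl).le) hy.le
      have e : (1 - Real.cos (y * Real.cosh T)) * H T / y
        = 2 * (H T / y) + (- Real.cos (y * Real.cosh T) * H T / y - H T / y) := by ring
      linarith
    linarith
  have hlo : -√2 ≤ ∫ t in T..R, f t := by
    have hd : ∀ t, T ≤ t → HasDerivAt (fun t => - Real.cos (y * Real.cosh t) * H t / y + H t / y)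
      (f t - Real.cos (y * Real.cosh t) * H' t / y + H' t / y) t :=
      fun t ht => (hFd t ht).add ((hHd t ht).div_const y)
    have := intervalIntegral.sub_le_integral_of_hasDeriv_right_of_le hR
      (fun t ht => (hd t ht.1).continuousAt.continuousWithinAt)
      (fun t ht => (hd t ht.1.le).hasDerivWithinAt) (φ := f) hfc.integrableOn_Icc
      (fun t ht => by
        have h1 := Real.cos_le_one (y * Real.cosh t)
        have h3 : 0 ≤ -((1 - Real.cos (y * Real.cosh t)) * H' t / y) := by
          rw [← neg_div]
          exact div_nonneg (by nlinarith [hH'neg t ht.1.le]) hy.le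
        have : (1 - Real.cos (y * Real.cosh t)) * H' t / y
          = - (Real.cos (y * Real.cosh t) * H' t / y) + H' t / y := by ring
        linarith)
    have hc1 := Real.cos_le_one (y * Real.cosh R)
    have hc2 := Real.neg_one_le_cos (y * Real.cosh T)
    have a1 : 0 ≤ - Real.cos (y * Real.cosh R) * H R / y + H R / y := by
      have : 0 ≤ (1 - Real.cos (y * Real.cosh R)) * H R / y :=
        div_nonneg (mul_nonneg (by linarith) (hHpos R hR).le) hy.le
      have e : (1 - Real.cos (y * Real.cosh R)) * H R / y
        = (- Real.cos (y * Real.cosh R) * H R / y + H R / y) := by ring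
      linarith
    have a2 : (- Real.cos (y * Real.cosh T) * H T / y + H T / y) ≤ 2 * (H T / y) := by
      have : 0 ≤ (1 + Real.cos (y * Real.cosh T)) * H T / y :=
        div_nonneg (mul_nonneg (by linarith) (hHpos T le_rfl).le) hy.le
      have e : (1 + Real.cos (y * Real.cosh T)) * H T / y
        = 2 * (H T / y) - (- Real.cos (y * Real.cosh T) * H T / y + H T / y) := by ring
      linarith
    linarith
  rw [← intervalIntegral.integral_add_adjacent_intervals (hfc.intervalIntegrable 0 T)
    (hfc.intervalIntegrable T R)]
  have := abs_le.mp hA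
  rw [abs_le]
  constructor <;> linarith [this.1, this.2]

lemma bk_C_bound (x y : ℝ) (hx : x ≠ 0) (R : ℝ) (hR : 0 ≤ R) :
    |∫ t in (0:ℝ)..R, Real.cosh t * Real.cos (y * Real.cosh t) / (Real.cosh t ^ 2 + x ^ 2)|
      ≤ Real.pi / (2 * |x|) := by
  have hx0 : 0 < |x| := abs_pos.mpr hx
  have hx2 : 0 < x ^ 2 := by positivity
  have hden : ∀ t, 0 < Real.sinh t ^ 2 + x ^ 2 := fun t => by positivity
  have hc : Continuous fun t => Real.cosh t / (Real.sinh t ^ 2 + x ^ 2) :=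
    Continuous.div (by fun_prop) (by fun_prop) fun t => (hden t).ne'
  have e : ∫ t in (0:ℝ)..R, Real.cosh t / (Real.sinh t ^ 2 + x ^ 2)
      = Real.arctan (Real.sinh R / |x|) / |x| := by
    rw [intervalIntegral.integral_eq_sub_of_hasDerivAt
      (f := fun t => Real.arctan (Real.sinh t / |x|) / |x|)]
    · simp
    · intro t _
      have := (((Real.hasDerivAt_sinh t).div_const |x|).arctan).div_const |x|
      refine this.congr_deriv ?_
      have := hden t
      rw [← sq_abs x] at this ⊢
      field_simp
      ring
    · exact hc.intervalIntegrable _ _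
  have h1 : |∫ t in (0:ℝ)..R, Real.cosh t * Real.cos (y * Real.cosh t) / (Real.cosh t ^ 2 + x ^ 2)|
      ≤ ∫ t in (0:ℝ)..R, Real.cosh t / (Real.sinh t ^ 2 + x ^ 2) := by
    rw [← Real.norm_eq_abs]
    refine intervalIntegral.norm_integral_le_of_norm_le hR
      (Filter.Eventually.of_forall fun t _ => ?_) (hc.intervalIntegrable _ _)
    have hcp := Real.cosh_pos t
    rw [Real.norm_eq_abs, abs_div, abs_mul, abs_of_pos hcp,
      abs_of_pos (show 0 < Real.cosh t ^ 2 + x ^ 2 by positivity)]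
    have := Real.cosh_sq t
    have := hden t
    refine div_le_div₀ hcp.le ?_ this (by linarith)
    have := Real.abs_cos_le_one (y * Real.cosh t)
    nlinarith
  refine h1.trans ?_
  rw [e, ← div_div]
  gcongr
  exact (Real.arctan_lt_pi_div_two _).le

lemma bk_inv_cosh_int : IntegrableOn (fun t : ℝ => 1 / Real.cosh t) (Set.Ioi 0) := by
  have h : IntegrableOn (fun t : ℝ => 2 * Real.exp (-t)) (Set.Ioi 0) :=
    (integrableOn_exp_neg_Ioi 0).const_mul 2
  refine Integrable.mono' h ?_ (Filter.Eventually.of_forall fun t => ?_)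
  · exact (Continuous.div (by fun_prop) (by fun_prop)
      fun t => (Real.cosh_pos t).ne').aestronglyMeasurable
  · have hcp := Real.cosh_pos t
    rw [Real.norm_eq_abs, abs_of_pos (by positivity), div_le_iff₀ hcp, Real.cosh_eq]
    have h1 : Real.exp (-t) * Real.exp t = 1 := by rw [← Real.exp_add]; simp
    nlinarith [Real.exp_pos (-t)]

lemma bk_swap (x y : ℝ) :
    ∫ ξ in Set.Ioi (0 : ℝ), Complex.exp (I * x * ξ) * besselK0 (ξ + I * y)
      = ∫ t in Set.Ioi (0 : ℝ), Complex.exp (-(I * y * Real.cosh t)) / (Real.cosh t - I * x) := by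
  set f : ℝ → ℝ → ℂ := fun ξ t => Complex.exp (I * x * ξ) *
    Complex.exp (-((ξ + I * y) * Real.cosh t)) with hf
  have hre : ∀ t : ℝ, (I * x - Real.cosh t : ℂ).re < 0 := fun t => by
    simpa [-ofReal_cosh] using Real.cosh_pos t
  have hf2 : ∀ ξ t, f ξ t = Complex.exp (-(I * y * Real.cosh t)) *
      Complex.exp ((I * x - Real.cosh t) * ξ) := fun ξ t => by
    simp only [hf]; rw [← Complex.exp_add, ← Complex.exp_add]; congr 1; ring
  have hnorm : ∀ ξ t, ‖f ξ t‖ = Real.exp (-Real.cosh t * ξ) := fun ξ t => by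
    simp only [hf]
    rw [← Complex.exp_add, Complex.norm_exp]
    congr 1
    simp [-ofReal_cosh]
    ring
  have hint : Integrable (Function.uncurry f)
      ((volume.restrict (Set.Ioi (0:ℝ))).prod (volume.restrict (Set.Ioi (0:ℝ)))) := by
    rw [integrable_prod_iff']
    · constructor
      · refine Filter.Eventually.of_forall fun t => ?_
        simp only [Function.uncurry, hf2]
        exact (integrableOn_exp_mul_complex_Ioi (hre t) 0).const_mul _
      · refine Integrable.congr bk_inv_cosh_int (Filter.Eventually.of_forall fun t => ?_)
        simp only [Function.uncurry, hnorm]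
        rw [integral_exp_mul_Ioi (by simpa using Real.cosh_pos t)]
        simp
    · refine Continuous.aestronglyMeasurable ?_
      simp only [hf]
      fun_prop
  have h1 : ∫ ξ in Set.Ioi (0 : ℝ), Complex.exp (I * x * ξ) * besselK0 (ξ + I * y)
      = ∫ ξ in Set.Ioi (0 : ℝ), ∫ t in Set.Ioi (0 : ℝ), f ξ t := by
    simp only [besselK0, hf, integral_const_mul]
  rw [h1, integral_integral_swap hint]
  congr 1
  ext t
  simp only [hf2, integral_const_mul]
  rw [integral_exp_mul_complex_Ioi (hre t)]
  have hne : (I * x - Real.cosh t : ℂ) ≠ 0 := fun h => by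
    have := hre t; rw [h] at this; simp at this
  have hne' : (Real.cosh t - I * x : ℂ) ≠ 0 := fun h => hne (by linear_combination -h)
  rw [ofReal_zero, mul_zero, Complex.exp_zero, div_eq_mul_inv _ (Real.cosh t - I * x : ℂ)]
  congr 1
  field_simp
  ring

lemma bk_re (x y t : ℝ) :
    (Complex.exp (-(I * y * Real.cosh t)) / (Real.cosh t - I * x)).re =
    Real.cosh t * Real.cos (y * Real.cosh t) / (Real.cosh t ^ 2 + x ^ 2) +
    x * Real.sin (y * Real.cosh t) / (Real.cosh t ^ 2 + x ^ 2) := by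
  have : (-(I * y * Real.cosh t) : ℂ) = ((-(y * Real.cosh t) : ℝ) : ℂ) * I := by push_cast; ring
  rw [this, Complex.div_re, Complex.exp_ofReal_mul_I_re, Complex.exp_ofReal_mul_I_im]
  simp [-ofReal_cosh, Complex.normSq_apply]
  ring

lemma bk_int (x y : ℝ) : IntegrableOn (fun t : ℝ =>
    Complex.exp (-(I * y * Real.cosh t)) / (Real.cosh t - I * x)) (Set.Ioi 0) := by
  have hre : ∀ t : ℝ, (Real.cosh t - I * x : ℂ).re = Real.cosh t := fun t => by
    simp [-ofReal_cosh]
  refine Integrable.mono' bk_inv_cosh_int ?_ (Filter.Eventually.of_forall fun t => ?_)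
  · refine (Continuous.div (by fun_prop) (by fun_prop) fun t h => ?_).aestronglyMeasurable
    have := hre t
    rw [h] at this
    exact (Real.cosh_pos t).ne' (by simpa using this.symm)
  · have hcp := Real.cosh_pos t
    rw [norm_div, Complex.norm_exp]
    have h1 : (-(I * y * Real.cosh t) : ℂ).re = 0 := by simp [-ofReal_cosh]
    rw [h1, Real.exp_zero]
    gcongr
    exact (hre t).symm.le.trans (Complex.re_le_norm _)

/-- For real `x ≠ 0` and `y > 0`, `|Re ∫_0^∞ e^{ixξ} K₀(ξ + iy) dξ| ≤ 3π/(2|x|)`. -/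
theorem re_integral_besselK0_bound (x y : ℝ) (hx : x ≠ 0) (hy : 0 < y) :
    |(∫ ξ in Set.Ioi (0 : ℝ), Complex.exp (I * x * ξ) * besselK0 (ξ + I * y)).re|
      ≤ 3 * Real.pi / (2 * |x|) := by
  have hx0 : 0 < |x| := abs_pos.mpr hx
  have hx2 : 0 < x ^ 2 := by positivity
  have hden : ∀ t : ℝ, Real.cosh t ^ 2 + x ^ 2 ≠ 0 := fun t => by positivity
  rw [bk_swap]
  have hI := bk_int x y
  have hre := integral_re hI
  simp only [RCLike.re_eq_complex_re] at hre
  rw [← hre]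
  have hlim := intervalIntegral_tendsto_integral_Ioi 0 hI.re Filter.tendsto_id
  refine le_of_tendsto hlim.abs ?_
  filter_upwards [Filter.eventually_ge_atTop (Real.arsinh (√2 / y)),
    Filter.eventually_ge_atTop 0] with R hR hR0
  simp only [RCLike.re_eq_complex_re, id, bk_re]
  rw [intervalIntegral.integral_add]
  rotate_left
  · exact (Continuous.div (by fun_prop) (by fun_prop) hden).intervalIntegrable _ _
  · exact (Continuous.div (by fun_prop) (by fun_prop) hden).intervalIntegrable _ _
  have e : ∫ t in (0:ℝ)..R, x * Real.sin (y * Real.cosh t) / (Real.cosh t ^ 2 + x ^ 2)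
      = x⁻¹ * ∫ t in (0:ℝ)..R, x ^ 2 * Real.sin (y * Real.cosh t) / (Real.cosh t ^ 2 + x ^ 2) := by
    rw [← intervalIntegral.integral_const_mul]
    congr 1
    ext t
    have := hden t
    field_simp
  have h1 := bk_C_bound x y hx R hR0
  have h2 := bk_S_bound x y hx hy R hR
  have h3 : 2 * √2 ≤ Real.pi := by
    have : √2 ≤ 1.5 := by rw [Real.sqrt_le_left (by norm_num)]; norm_num
    linarith [Real.pi_gt_three]
  rw [e]
  refine (abs_add_le _ _).trans ?_
  rw [abs_mul, abs_inv]
  calc _ ≤ Real.pi / (2 * |x|) + |x|⁻¹ * Real.pi := by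
        gcongr
        exact h2.trans h3
    _ = _ := by field_simp; ring
end

section
/- For 0 < Re(α) < 2 and τ ≠ 0, the function ξ ↦ (|ξ|² + 2iτξ₁ − τ²)^{−α} is locally integrable on R^n. -/
open MeasureTheory Complex

open scoped ENNReal

lemma aux_one_dim (s : ℝ) (hs0 : 0 < s) (hs : s < 1) (R : ℝ) (hR : 0 < R) :
    ∫⁻ x in Metric.ball (0 : ℝ) R, ‖x‖ₑ ^ (-s) < ∞ := by
  have h1 : IntegrableOn (fun x : ℝ => (‖x‖ : ℝ) ^ (-s)) (Metric.ball (0 : ℝ) R) volume := by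
    rw [integrableOn_fun_norm_addHaar (μ := (volume : Measure ℝ)) (f := fun y : ℝ => y ^ (-s))]
    simpa using (intervalIntegral.integrableOn_Ioo_rpow_iff hR).2 (by linarith)
  have h2 := h1.2
  refine lt_of_eq_of_lt ?_ h2
  refine lintegral_congr_ae ?_
  refine ae_restrict_of_ae ?_
  filter_upwards [(measure_singleton (μ := volume) (0 : ℝ) : _) |> compl_mem_ae_iff.2] with x hx
  have hx' : x ≠ 0 := hx
  have hpos : 0 < ‖x‖ := norm_pos_iff.2 hx'
  rw [Real.enorm_eq_ofReal (r := ‖x‖ ^ (-s)) (by positivity), ← ENNReal.ofReal_rpow_of_pos hpos, ofReal_norm]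

lemma aux_shift (s : ℝ) (hs0 : 0 < s) (hs : s < 1) (c R : ℝ) (hR : 0 < R) :
    ∫⁻ x in Metric.ball c R, ‖x - c‖ₑ ^ (-s) < ∞ := by
  have h := aux_one_dim s hs0 hs R hR
  rw [← lintegral_indicator Metric.isOpen_ball.measurableSet] at h ⊢
  rw [← lintegral_sub_right_eq_self _ c] at h
  refine lt_of_eq_of_lt ?_ h
  congr 1 with x
  by_cases hx : x ∈ Metric.ball c R
  · have : x - c ∈ Metric.ball (0 : ℝ) R := by
      simpa [Metric.mem_ball, Real.dist_eq] using hx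
    simp only [Set.indicator_of_mem hx, Set.indicator_of_mem this]
  · have : x - c ∉ Metric.ball (0 : ℝ) R := by
      simpa [Metric.mem_ball, Real.dist_eq] using hx
    simp only [Set.indicator_of_notMem hx, Set.indicator_of_notMem this]

lemma aux_coord (n : ℕ) (i : Fin n) (s : ℝ) (hs0 : 0 < s) (hs : s < 1) :
    ∫⁻ ξ in Metric.ball (0 : EuclideanSpace ℝ (Fin n)) 1, ‖ξ i‖ₑ ^ (-s) < ∞ := by
  have hm : Measurable (fun x : ℝ => ‖x‖ₑ ^ (-s)) := by fun_prop
  let S : Set (Fin n → ℝ) := Set.univ.pi (fun _ => Metric.ball (0 : ℝ) 1)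
  have hS : MeasurableSet S := MeasurableSet.univ_pi fun _ => Metric.isOpen_ball.measurableSet
  have h1 : ∫⁻ x in S, ‖x i‖ₑ ^ (-s) < ∞ := by
    rw [volume_pi, Measure.restrict_pi_pi,
      ← lintegral_map (f := fun x : ℝ => ‖x‖ₑ ^ (-s)) (g := fun x : Fin n → ℝ => x i) hm
        (measurable_pi_apply i)]
    have := Measure.pi_map_eval (μ := fun _ : Fin n => (volume : Measure ℝ).restrict (Metric.ball (0 : ℝ) 1)) i
    unfold Function.eval at this
    rw [this, lintegral_smul_measure]
    refine ENNReal.mul_lt_top ?_ (aux_one_dim s hs0 hs 1 one_pos)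
    refine ENNReal.prod_lt_top fun j _ => ?_
    rw [Measure.restrict_apply_univ]
    exact measure_ball_lt_top
  have h2 := (EuclideanSpace.volume_preserving_symm_measurableEquiv_toLp (Fin n)).setLIntegral_comp_preimage_emb (MeasurableEquiv.measurableEmbedding _) (fun x : Fin n → ℝ => ‖x i‖ₑ ^ (-s)) S
  rw [← h2] at h1
  refine lt_of_le_of_lt ?_ h1
  refine lintegral_mono_set ?_
  intro ξ hξ
  simp only [S, Set.mem_preimage, Set.mem_pi]
  intro j _
  rw [mem_ball_zero_iff] at *
  exact (PiLp.norm_apply_le ξ j).trans_lt hξ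

lemma aux_polar {E : Type*} [NormedAddCommGroup E] [NormedSpace ℝ E] [FiniteDimensional ℝ E]
    [MeasurableSpace E] [BorelSpace E] [Nontrivial E] (μ : Measure E) [μ.IsAddHaarMeasure]
    (h : E → ℝ≥0∞) (hh : Measurable h) (s : ℝ)
    (hom : ∀ (r : ℝ) (x : E), 0 < r → h (r • x) = ‖r‖ₑ ^ (-s) * h x)
    (G : ℝ → ℝ≥0∞) (hG : Measurable G) :
    ∫⁻ x, G ‖x‖ * h x ∂μ = (∫⁻ ω, h ω.1 ∂μ.toSphere) *
      ∫⁻ r in Set.Ioi (0 : ℝ), ENNReal.ofReal (r ^ (Module.finrank ℝ E - 1)) *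
        (G r * ‖r‖ₑ ^ (-s)) := by
  have e := μ.measurePreserving_homeomorphUnitSphereProd
  have hm : Measurable (fun r : ℝ => G r * ‖r‖ₑ ^ (-s)) := by fun_prop
  calc ∫⁻ x, G ‖x‖ * h x ∂μ
      = ∫⁻ x : ({(0)}ᶜ : Set E), G ‖x.1‖ * h x.1 ∂(μ.comap (↑)) := by
        rw [lintegral_subtype_comap (measurableSet_singleton _).compl fun x ↦ G ‖x‖ * h x,
          restrict_compl_singleton]
    _ = ∫⁻ x : ({(0)}ᶜ : Set E), (fun p : Metric.sphere (0 : E) 1 × Set.Ioi (0 : ℝ) =>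
          h p.1.1 * (G p.2.1 * ‖p.2.1‖ₑ ^ (-s))) (homeomorphUnitSphereProd E x) ∂(μ.comap (↑)) := by
        congr 1 with x
        have hx : x.1 ≠ 0 := x.2
        have hp : 0 < ‖x.1‖ := norm_pos_iff.2 hx
        have h3 : x.1 = ‖x.1‖ • (‖x.1‖⁻¹ • x.1) := by
          rw [smul_smul, mul_inv_cancel₀ hp.ne', one_smul]
        have h4 := hom ‖x.1‖ (‖x.1‖⁻¹ • x.1) hp
        rw [← h3] at h4
        simp only [homeomorphUnitSphereProd_apply_snd_coe, homeomorphUnitSphereProd_apply_fst_coe]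
        rw [h4]; ring
    _ = ∫⁻ p, h p.1.1 * (G p.2.1 * ‖p.2.1‖ₑ ^ (-s)) ∂(μ.toSphere.prod
          (.volumeIoiPow (Module.finrank ℝ E - 1))) :=
        e.lintegral_comp_emb (Homeomorph.measurableEmbedding _)
          (fun p : Metric.sphere (0 : E) 1 × Set.Ioi (0 : ℝ) =>
            h p.1.1 * (G p.2.1 * ‖p.2.1‖ₑ ^ (-s)))
    _ = (∫⁻ ω, h ω.1 ∂μ.toSphere) * ∫⁻ r : Set.Ioi (0 : ℝ), (G r.1 * ‖r.1‖ₑ ^ (-s))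
          ∂(.volumeIoiPow (Module.finrank ℝ E - 1)) :=
        lintegral_prod_mul (f := fun ω : Metric.sphere (0 : E) 1 => h ω.1)
          (g := fun r : Set.Ioi (0 : ℝ) => G r.1 * ‖r.1‖ₑ ^ (-s))
          (hh.comp measurable_subtype_coe).aemeasurable
          (hm.comp measurable_subtype_coe).aemeasurable
    _ = _ := by
        congr 1
        rw [Measure.volumeIoiPow, lintegral_withDensity_eq_lintegral_mul]
        · rw [← lintegral_subtype_comap measurableSet_Ioi]
          rfl
        · fun_prop
        · exact hm.comp measurable_subtype_coe

lemma aux_sphere (n : ℕ) (i : Fin n) (s : ℝ) (hs0 : 0 < s) (hs : s < 1) :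
    ∫⁻ ω, ‖ω.1 i‖ₑ ^ (-s) ∂(volume : Measure (EuclideanSpace ℝ (Fin n))).toSphere < ∞ := by
  have : Nonempty (Fin n) := ⟨i⟩
  have h := aux_polar (volume : Measure (EuclideanSpace ℝ (Fin n))) (fun ξ => ‖ξ i‖ₑ ^ (-s))
    (by fun_prop) s (fun r x hr => by
      simp only [PiLp.smul_apply, smul_eq_mul, enorm_mul]
      exact ENNReal.mul_rpow_of_ne_top enorm_ne_top enorm_ne_top _)
    ((Set.Iio 1).indicator 1) (measurable_one.indicator measurableSet_Iio)
  have h1 := aux_coord n i s hs0 hs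
  rw [← lintegral_indicator Metric.isOpen_ball.measurableSet] at h1
  have h2 : ∫⁻ x : EuclideanSpace ℝ (Fin n), (Set.Iio 1).indicator 1 ‖x‖ * ‖x i‖ₑ ^ (-s) < ∞ := by
    refine lt_of_eq_of_lt ?_ h1
    congr 1 with x
    by_cases hx : ‖x‖ < 1 <;> simp [Set.indicator, hx]
  rw [h] at h2
  refine ENNReal.lt_top_of_mul_ne_top_left h2.ne ?_
  intro h0
  rw [lintegral_eq_zero_iff (by
    have := (measurable_one (α := ℝ≥0∞) (β := ℝ)).indicator (measurableSet_Iio (a := (1:ℝ)))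
    fun_prop)] at h0
  have h3 : ∀ᵐ r : ℝ, r ∉ Set.Ioo (0:ℝ) 1 := by
    filter_upwards [(ae_restrict_iff' measurableSet_Ioi).1 h0] with r hr hr1
    have := hr hr1.1
    have hp : 0 < r := hr1.1
    have h5 : r < 1 := hr1.2
    simp [Set.indicator, h5, ENNReal.rpow_eq_zero_iff, hp.ne', not_le.2 (pow_pos hp _)] at this
  have h4 : volume (Set.Ioo (0:ℝ) 1) = 0 := measure_eq_zero_iff_ae_notMem.2 h3
  simp at h4

lemma aux_radial (m : ℕ) (τ s : ℝ) (hτ : τ ≠ 0) (hs0 : 0 < s) (hs : s < 1) (hm : 1 ≤ m) (R : ℝ) (hR : 0 < R) :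
    ∫⁻ r in Set.Ioi (0 : ℝ), ENNReal.ofReal (r ^ m) *
      ((Set.Iio R).indicator (fun r => ‖r ^ 2 - τ ^ 2‖ₑ ^ (-s)) r * ‖r‖ₑ ^ (-s)) < ∞ := by
  have h1 := aux_shift s hs0 hs |τ| (R + |τ|) (by positivity)
  have hC : ENNReal.ofReal (R ^ ((m:ℝ) - s)) * ‖τ‖ₑ ^ (-s) ≠ ∞ :=
    ENNReal.mul_ne_top ENNReal.ofReal_ne_top (by simp [ENNReal.rpow_eq_top_iff, hτ])
  have h2 := ENNReal.mul_lt_top hC.lt_top h1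
  rw [← lintegral_const_mul _ (by fun_prop)] at h2
  refine lt_of_le_of_lt ?_ h2
  rw [← lintegral_indicator measurableSet_Ioi, ← lintegral_indicator Metric.isOpen_ball.measurableSet]
  refine lintegral_mono fun r => ?_
  by_cases hr0 : 0 < r
  swap
  · simp [Set.indicator, hr0]
  by_cases hrR : r < R
  swap
  · simp [Set.indicator, hrR]
  have hb : r ∈ Metric.ball |τ| (R + |τ|) := by
    rw [Metric.mem_ball, Real.dist_eq, abs_lt]
    constructor <;> linarith [abs_nonneg τ]
  rw [Set.indicator_of_mem (show r ∈ Set.Ioi 0 from hr0), Set.indicator_of_mem hb,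
    Set.indicator_of_mem (show r ∈ Set.Iio R from hrR)]
  have h3 : ‖r ^ 2 - τ ^ 2‖ₑ ^ (-s) ≤ ‖τ‖ₑ ^ (-s) * ‖r - |τ|‖ₑ ^ (-s) := by
    rw [← ENNReal.mul_rpow_of_ne_top enorm_ne_top enorm_ne_top, ← enorm_mul]
    rw [ENNReal.rpow_neg, ENNReal.rpow_neg, ENNReal.inv_le_inv]
    refine ENNReal.rpow_le_rpow ?_ hs0.le
    rw [enorm_le_iff_norm_le, norm_mul, ← sq_abs τ, sq_sub_sq, norm_mul]
    refine mul_le_mul_of_nonneg_right ?_ (norm_nonneg _)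
    rw [Real.norm_eq_abs, Real.norm_eq_abs, abs_of_pos (a := r + |τ|) (by positivity)]
    linarith
  have h4 : ENNReal.ofReal (r ^ m) * ‖r‖ₑ ^ (-s) ≤ ENNReal.ofReal (R ^ ((m:ℝ) - s)) := by
    rw [Real.enorm_eq_ofReal hr0.le, ENNReal.ofReal_rpow_of_pos hr0,
      ← ENNReal.ofReal_mul (by positivity), ← Real.rpow_natCast, ← Real.rpow_add hr0]
    refine ENNReal.ofReal_le_ofReal ?_
    refine Real.rpow_le_rpow hr0.le hrR.le ?_
    have : (1:ℝ) ≤ m := by exact_mod_cast hm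
    linarith
  calc _ = (ENNReal.ofReal (r ^ m) * ‖r‖ₑ ^ (-s)) * ‖r ^ 2 - τ ^ 2‖ₑ ^ (-s) := by ring
    _ ≤ _ := by
      refine (mul_le_mul' h4 h3).trans (le_of_eq ?_)
      ring

lemma aux_pointwise (α z : ℂ) (hα : 0 < α.re) :
    ‖z ^ (-α)‖ₑ ≤ ENNReal.ofReal (Real.exp (Real.pi * |α.im|)) *
      (‖z.re‖ₑ ^ (-(α.re / 2)) * ‖z.im‖ₑ ^ (-(α.re / 2))) := by
  by_cases hz : z = 0
  · have : -α ≠ 0 := by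
      intro h
      rw [neg_eq_zero] at h
      simp [h] at hα
    simp [hz, Complex.zero_cpow this]
  have hp : 0 < ‖z‖ := norm_pos_iff.2 hz
  have h1 : ‖z ^ (-α)‖ ≤ Real.exp (Real.pi * |α.im|) * ‖z‖ ^ (-α.re) := by
    refine (norm_cpow_le z (-α)).trans ?_
    rw [div_eq_mul_inv, ← Real.exp_neg, mul_comm, neg_re, neg_im]
    refine mul_le_mul_of_nonneg_right (Real.exp_le_exp.2 ?_) (by positivity)
    rw [mul_neg, neg_neg]
    refine (le_abs_self _).trans ?_
    rw [abs_mul]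
    exact mul_le_mul_of_nonneg_right (abs_arg_le_pi z) (abs_nonneg _)
  have h2 : ‖z‖ₑ ^ (-α.re) ≤ ‖z.re‖ₑ ^ (-(α.re / 2)) * ‖z.im‖ₑ ^ (-(α.re / 2)) := by
    rw [← ENNReal.mul_rpow_of_ne_top enorm_ne_top enorm_ne_top]
    rw [show -α.re = 2 * (-(α.re / 2)) by ring, ENNReal.rpow_mul]
    rw [ENNReal.rpow_neg, ENNReal.rpow_neg, ENNReal.inv_le_inv]
    refine ENNReal.rpow_le_rpow ?_ (by positivity)
    rw [ENNReal.rpow_ofNat, sq]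
    refine mul_le_mul' ?_ ?_
    · rw [enorm_le_iff_norm_le]; exact abs_re_le_norm z
    · rw [enorm_le_iff_norm_le]; exact abs_im_le_norm z
  calc ‖z ^ (-α)‖ₑ = ENNReal.ofReal ‖z ^ (-α)‖ := (ofReal_norm _).symm
    _ ≤ ENNReal.ofReal (Real.exp (Real.pi * |α.im|) * ‖z‖ ^ (-α.re)) := ENNReal.ofReal_le_ofReal h1
    _ = ENNReal.ofReal (Real.exp (Real.pi * |α.im|)) * ‖z‖ₑ ^ (-α.re) := by
      rw [ENNReal.ofReal_mul (by positivity), ← ENNReal.ofReal_rpow_of_pos hp, ofReal_norm]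
    _ ≤ _ := mul_le_mul' le_rfl h2

/-- For `0 < Re α < 2` and `τ ≠ 0`, the function
`ξ ↦ (|ξ|² + 2iτξ₁ − τ²)^{-α}` is locally integrable on `ℝⁿ` (`n ≥ 3`). -/
theorem conjugated_symbol_neg_cpow_locallyIntegrable (n : ℕ) (hn : 3 ≤ n)
    (τ : ℝ) (hτ : τ ≠ 0) (α : ℂ) (hα₁ : 0 < α.re) (hα₂ : α.re < 2) :
    LocallyIntegrable
      (fun ξ : EuclideanSpace ℝ (Fin n) =>
        (((‖ξ‖ ^ 2 : ℝ) : ℂ) + 2 * I * (τ : ℂ) * (ξ ⟨0, by omega⟩ : ℝ)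
          - ((τ : ℝ) : ℂ) ^ 2) ^ (-α))
      volume := by
  intro x
  refine ⟨Metric.ball 0 (‖x‖ + 1), Metric.isOpen_ball.mem_nhds (by simp), ?_⟩
  set R := ‖x‖ + 1 with hRdef
  have hR : 0 < R := by positivity
  set i : Fin n := ⟨0, by omega⟩ with hi
  have : Nonempty (Fin n) := ⟨i⟩
  set s := α.re / 2 with hsdef
  have hs0 : 0 < s := by positivity
  have hs1 : s < 1 := by linarith
  refine ⟨?_, ?_⟩
  · refine Measurable.aestronglyMeasurable ?_
    refine Measurable.pow_const ?_ _
    fun_prop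
  have hGm : Measurable ((Set.Iio R).indicator (fun r : ℝ => ‖r ^ 2 - τ ^ 2‖ₑ ^ (-s))) := by
    refine Measurable.indicator ?_ measurableSet_Iio
    fun_prop
  have h := aux_polar (volume : Measure (EuclideanSpace ℝ (Fin n))) (fun ξ => ‖ξ i‖ₑ ^ (-s))
    (by fun_prop) s (fun r x hr => by
      simp only [PiLp.smul_apply, smul_eq_mul, enorm_mul]
      exact ENNReal.mul_rpow_of_ne_top enorm_ne_top enorm_ne_top _)
    _ hGm
  have hfin : ∫⁻ ξ : EuclideanSpace ℝ (Fin n),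
      (Set.Iio R).indicator (fun r : ℝ => ‖r ^ 2 - τ ^ 2‖ₑ ^ (-s)) ‖ξ‖ * ‖ξ i‖ₑ ^ (-s) < ∞ := by
    rw [h]
    refine ENNReal.mul_lt_top (aux_sphere n i s hs0 hs1) ?_
    refine aux_radial _ τ s hτ hs0 hs1 ?_ R hR
    simp only [finrank_euclideanSpace, Fintype.card_fin]
    omega
  have hC : ENNReal.ofReal (Real.exp (Real.pi * |α.im|)) * ‖2 * τ‖ₑ ^ (-s) < ∞ :=
    ENNReal.mul_lt_top ENNReal.ofReal_lt_top
      (lt_top_iff_ne_top.2 (by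
        have h2τ : ‖2 * τ‖ₑ ≠ 0 := by simp [hτ]
        have h2τ' : ‖2 * τ‖ₑ ≠ ∞ := enorm_ne_top
        exact ENNReal.rpow_ne_top_of_ne_zero h2τ h2τ'))
  have hfin2 := ENNReal.mul_lt_top hC hfin
  rw [← lintegral_const_mul _ (by
    have := hGm.comp (measurable_norm (α := EuclideanSpace ℝ (Fin n)))
    simp only [Function.comp_def] at this
    fun_prop)] at hfin2
  refine lt_of_le_of_lt ?_ hfin2
  rw [← lintegral_indicator Metric.isOpen_ball.measurableSet]
  refine lintegral_mono fun ξ => ?_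
  by_cases hξ : ‖ξ‖ < R
  swap
  · rw [Set.indicator_of_notMem (by simpa using hξ)]
    exact zero_le
  rw [Set.indicator_of_mem (by simpa using hξ), Set.indicator_of_mem (show ‖ξ‖ ∈ Set.Iio R from hξ)]
  refine (aux_pointwise α _ hα₁).trans (le_of_eq ?_)
  set z : ℂ := ((‖ξ‖ ^ 2 : ℝ) : ℂ) + 2 * I * (τ : ℂ) * (ξ i : ℝ) - ((τ : ℝ) : ℂ) ^ 2 with hz
  have hre : z.re = ‖ξ‖ ^ 2 - τ ^ 2 := by
    simp [hz, ← ofReal_pow]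
  have him : z.im = (2 * τ) * ξ i := by
    simp [hz, ← ofReal_pow]
  rw [hre, him, enorm_mul (2 * τ), ENNReal.mul_rpow_of_ne_top enorm_ne_top enorm_ne_top]
  ring
end
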